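/- arXiv:2603.00891 — 2 statements merged into one kernel-verified Lean document; each statement's English description precedes it below -/
import Mathlib

section
/- Let (Ω,ℱ,P) be a complete probability space, let H be a separable real Hilbert space, and let x, y, z be square-integrable H-valued random variables. Suppose there exists a square-integrable H-valued random variable u such that u(ω) ∈ O(x(ω), y(ω), z(ω)) for P-a.e. ω. Then the map ω ↦ Q(x(ω), y(ω), z(ω)) is a square-integrable H-valued random variable, i.e. it is measurable and E‖Q(x,y,z)‖² < +∞. In particular, this holds if there exists a deterministic point u ∈ H with u ∈ O(x(ω), y(ω), z(ω)) for P-a.e. ω. -/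
open MeasureTheory RealInnerProductSpace

/-- The half-space `H(x,y) = {z : ⟪z - y, x - y⟫ ≤ 0}`. -/
def halfSpace {H : Type*} [NormedAddCommGroup H] [InnerProductSpace ℝ H] (x y : H) : Set H :=
  {z : H | ⟪z - y, x - y⟫ ≤ 0}

open scoped Classical in
/-- The outer set `O(x,y,z)`. -/
noncomputable def Oset {H : Type*} [NormedAddCommGroup H] [InnerProductSpace ℝ H]
    (x y z : H) : Set H :=
  if (halfSpace x y ∩ halfSpace y z).Nonempty then halfSpace x y ∩ halfSpace y z else {y}

/-- `q` is the metric projection of `x` onto `C`. -/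
def IsProjPt {H : Type*} [NormedAddCommGroup H] [InnerProductSpace ℝ H]
    (C : Set H) (x q : H) : Prop :=
  q ∈ C ∧ ∀ w ∈ C, ‖x - q‖ ≤ ‖x - w‖

section HaugazeauProjection

variable {H : Type*} [NormedAddCommGroup H] [InnerProductSpace ℝ H]

/-- A point satisfying the variational inequality against `q` is the only one at least as close
to `x` as itself. -/
lemma eq_of_norm_sub_le_of_inner_nonpos {x p q : H} (hle : ‖x - q‖ ≤ ‖x - p‖)
    (hvar : ⟪x - p, q - p⟫ ≤ 0) : q = p := by
  have hexp : ‖x - q‖ ^ 2 = ‖x - p‖ ^ 2 - 2 * ⟪x - p, q - p⟫ + ‖q - p‖ ^ 2 := by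
    rw [← norm_sub_sq_real, sub_sub_sub_cancel_right]
  have hsq : ‖x - q‖ ^ 2 ≤ ‖x - p‖ ^ 2 := by gcongr
  have hzero : ‖q - p‖ = 0 := by
    rw [← sq_eq_zero_iff]
    exact le_antisymm (by linarith) (sq_nonneg _)
  exact sub_eq_zero.mp (norm_eq_zero.mp hzero)

/-- The Karush-Kuhn-Tucker conditions identify the projection onto `Oset x y z`. -/
lemma IsProjPt.eq_of_kkt {x y z p q : H} (hq : IsProjPt (Oset x y z) x q) {α β : ℝ}
    (hα : 0 ≤ α) (hβ : 0 ≤ β) (hxy : ⟪p - y, x - y⟫ ≤ 0) (hyz : ⟪p - z, y - z⟫ ≤ 0)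
    (hp : x - p = α • (x - y) + β • (y - z))
    (hαxy : α * ⟪p - y, x - y⟫ = 0) (hβyz : β * ⟪p - z, y - z⟫ = 0) : q = p := by
  have hpO : p ∈ halfSpace x y ∩ halfSpace y z := ⟨hxy, hyz⟩
  rw [Oset, if_pos ⟨p, hpO⟩] at hq
  obtain ⟨⟨hqxy, hqyz⟩, hmin⟩ := hq
  refine eq_of_norm_sub_le_of_inner_nonpos (hmin p hpO) ?_
  have hinner : ⟪x - p, q - p⟫ = α * ⟪q - y, x - y⟫ + β * ⟪q - z, y - z⟫
      - α * ⟪p - y, x - y⟫ - β * ⟪p - z, y - z⟫ := by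
    rw [hp, inner_add_left, real_inner_smul_left, real_inner_smul_left,
      ← sub_sub_sub_cancel_right q p y, inner_sub_right (x - y),
      sub_sub_sub_cancel_right q p y, ← sub_sub_sub_cancel_right q p z,
      inner_sub_right (y - z), real_inner_comm (x - y), real_inner_comm (x - y),
      real_inner_comm (y - z), real_inner_comm (y - z)]
    ring
  rw [hinner, hαxy, hβyz]
  have h₁ := mul_nonpos_of_nonneg_of_nonpos hα hqxy
  have h₂ := mul_nonpos_of_nonneg_of_nonpos hβ hqyz
  linarith

/-- The Gram determinant of `x - y` and `y - z`. -/
noncomputable def gramDet (x y z : H) : ℝ :=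
  ‖x - y‖ ^ 2 * ‖y - z‖ ^ 2 - ⟪x - y, y - z⟫ ^ 2

open scoped Classical in
/-- Haugazeau's closed formula for the projection of `x` onto `Oset x y z`. -/
noncomputable def haugazeau (x y z : H) : H :=
  if gramDet x y z ≤ 0 then
    if 0 ≤ ⟪x - y, y - z⟫ then z else y
  else if gramDet x y z ≤ ⟪x - y, y - z⟫ * ‖y - z‖ ^ 2 then
    x - (1 + ⟪x - y, y - z⟫ / ‖y - z‖ ^ 2) • (y - z)
  else
    y + (‖y - z‖ ^ 2 / gramDet x y z) •
      (⟪x - y, y - z⟫ • (x - y) - ‖x - y‖ ^ 2 • (y - z))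

/-- If `x - y` and `y - z` are linearly dependent, then `x - y` is a multiple of `y - z` unless
the latter vanishes. -/
lemma sub_eq_smul_of_gramDet_nonpos {x y z : H} (hdet : gramDet x y z ≤ 0) (hyz : y - z ≠ 0) :
    x - y = (⟪x - y, y - z⟫ / ‖y - z‖ ^ 2) • (y - z) := by
  have hn : 0 < ‖y - z‖ ^ 2 := by positivity
  rw [← sub_eq_zero, ← norm_eq_zero, ← sq_eq_zero_iff]
  refine le_antisymm ?_ (sq_nonneg _)
  rw [norm_sub_sq_real, norm_smul, mul_pow, real_inner_smul_right, Real.norm_eq_abs, sq_abs]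
  have hquot : ‖x - y‖ ^ 2 - 2 * (⟪x - y, y - z⟫ / ‖y - z‖ ^ 2 * ⟪x - y, y - z⟫)
      + (⟪x - y, y - z⟫ / ‖y - z‖ ^ 2) ^ 2 * ‖y - z‖ ^ 2
      = gramDet x y z / ‖y - z‖ ^ 2 := by
    rw [gramDet]
    field_simp
    ring
  rw [hquot]
  exact div_nonpos_of_nonpos_of_nonneg hdet hn.le

/-- `haugazeau x y z` is the only candidate for the projection of `x` onto `Oset x y z`. -/
lemma IsProjPt.eq_haugazeau {x y z q : H} (hq : IsProjPt (Oset x y z) x q) :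
    q = haugazeau x y z := by
  have haa : ⟪x - y, x - y⟫ = ‖x - y‖ ^ 2 := real_inner_self_eq_norm_sq _
  have hbb : ⟪y - z, y - z⟫ = ‖y - z‖ ^ 2 := real_inner_self_eq_norm_sq _
  have hba : ⟪y - z, x - y⟫ = ⟪x - y, y - z⟫ := real_inner_comm _ _
  rw [haugazeau]
  split_ifs with hdet hχ hcase
  · have hzy : ⟪z - y, x - y⟫ ≤ 0 := by
      rw [← neg_sub y z, inner_neg_left, hba]
      linarith
    by_cases hb : y - z = 0
    · refine hq.eq_of_kkt zero_le_one le_rfl hzy (by simp) ?_ ?_ (by simp)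
      · rw [sub_eq_zero.mp hb]
        simp
      · rw [sub_eq_zero.mp hb]
        simp
    · refine hq.eq_of_kkt (α := 0) (β := 1 + ⟪x - y, y - z⟫ / ‖y - z‖ ^ 2) le_rfl
        (by positivity) hzy (by simp) ?_ (by simp) (by simp)
      rw [zero_smul, zero_add, add_smul, one_smul, ← sub_eq_smul_of_gramDet_nonpos hdet hb]
      abel
  · have hb : y - z ≠ 0 := fun h => hχ (by simp [h])
    have hn : 0 < ‖y - z‖ ^ 2 := by positivity
    have hempty : ¬ (halfSpace x y ∩ halfSpace y z).Nonempty := by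
      rintro ⟨w, hwxy, hwyz⟩
      simp only [halfSpace, Set.mem_ofPred_eq] at hwxy hwyz
      rw [sub_eq_smul_of_gramDet_nonpos hdet hb, real_inner_smul_right] at hwxy
      have hneg : ⟪x - y, y - z⟫ / ‖y - z‖ ^ 2 < 0 := div_neg_of_neg_of_pos (not_le.mp hχ) hn
      have hnonneg := nonneg_of_mul_nonpos_right hwxy hneg
      rw [← sub_add_sub_cancel w y z, inner_add_left, hbb] at hwyz
      linarith
    rw [Oset, if_neg hempty] at hq
    exact hq.1
  · rw [not_le] at hdet
    have hb : y - z ≠ 0 := fun h => by simp [gramDet, h] at hdet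
    have hn : 0 < ‖y - z‖ ^ 2 := by positivity
    have hχ : 0 < ⟪x - y, y - z⟫ := pos_of_mul_pos_left (hdet.trans_le hcase) hn.le
    set c := 1 + ⟪x - y, y - z⟫ / ‖y - z‖ ^ 2 with hc
    have hpz : ⟪x - c • (y - z) - z, y - z⟫ = 0 := by
      rw [show x - c • (y - z) - z = (x - y) + (y - z) - c • (y - z) by abel,
        inner_sub_left, inner_add_left, real_inner_smul_left, hbb, hc]
      field_simp
      ring
    refine hq.eq_of_kkt (α := 0) (β := c) le_rfl (by positivity) ?_ hpz.le (by simp) (by simp)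
      (by rw [hpz, mul_zero])
    have hpy : ⟪x - c • (y - z) - y, x - y⟫
        = (gramDet x y z - ⟪x - y, y - z⟫ * ‖y - z‖ ^ 2) / ‖y - z‖ ^ 2 := by
      rw [show x - c • (y - z) - y = (x - y) - c • (y - z) by abel,
        inner_sub_left, real_inner_smul_left, haa, hba, hc, gramDet]
      field_simp
      ring
    rw [hpy]
    exact div_nonpos_of_nonpos_of_nonneg (by linarith) hn.le
  · rw [not_le] at hdet hcase
    set d := gramDet x y z with hd
    set r := ‖y - z‖ ^ 2 / d with hr
    set p := y + r • (⟪x - y, y - z⟫ • (x - y) - ‖x - y‖ ^ 2 • (y - z)) with hp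
    have hpy : ⟪p - y, x - y⟫ = 0 := by
      rw [hp, add_sub_cancel_left, real_inner_smul_left, inner_sub_left, real_inner_smul_left,
        real_inner_smul_left, haa, hba]
      ring
    have hpz : ⟪p - z, y - z⟫ = 0 := by
      rw [hp, add_sub_right_comm, inner_add_left, real_inner_smul_left,
        inner_sub_left (⟪x - y, y - z⟫ • (x - y)), real_inner_smul_left, real_inner_smul_left,
        hbb, hr,
        show ⟪x - y, y - z⟫ * ⟪x - y, y - z⟫ - ‖x - y‖ ^ 2 * ‖y - z‖ ^ 2 = -d by
          rw [hd, gramDet]; ring]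
      field_simp
      ring
    refine hq.eq_of_kkt (α := 1 - r * ⟪x - y, y - z⟫) (β := r * ‖x - y‖ ^ 2) ?_
      (by positivity) hpy.le hpz.le ?_ (by rw [hpy, mul_zero]) (by rw [hpz, mul_zero])
    · rw [sub_nonneg, hr, div_mul_eq_mul_div, div_le_one hdet, mul_comm]
      exact hcase.le
    · rw [hp]
      module

lemma measurable_haugazeau [SecondCountableTopology H] [MeasurableSpace H] [BorelSpace H] :
    Measurable fun v : H × H × H => haugazeau v.1 v.2.1 v.2.2 := by
  have hdet : Measurable fun v : H × H × H => gramDet v.1 v.2.1 v.2.2 := by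
    unfold gramDet
    fun_prop
  have hχ : Measurable fun v : H × H × H => ⟪v.1 - v.2.1, v.2.1 - v.2.2⟫ := by fun_prop
  unfold haugazeau
  refine Measurable.ite (measurableSet_le hdet measurable_const)
    (Measurable.ite (measurableSet_le measurable_const hχ) (by fun_prop) (by fun_prop))
    (Measurable.ite (measurableSet_le hdet (by fun_prop)) (by fun_prop) (by fun_prop))

end HaugazeauProjection

/-- If `x, y, z` are square-integrable `H`-valued random variables and some square-integrable
random variable `u` satisfies `u ∈ O(x,y,z)` a.s., then `ω ↦ Q(x(ω),y(ω),z(ω))` is a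
square-integrable random variable. -/
theorem Q_of_random_memLp {Ω : Type*} [MeasurableSpace Ω] (μ : Measure Ω)
    [IsProbabilityMeasure μ] [μ.IsComplete]
    {H : Type*} [NormedAddCommGroup H] [InnerProductSpace ℝ H] [CompleteSpace H]
    [SecondCountableTopology H] [MeasurableSpace H] [BorelSpace H]
    (x y z u : Ω → H)
    (hx : MemLp x 2 μ) (hy : MemLp y 2 μ) (hz : MemLp z 2 μ) (hu : MemLp u 2 μ)
    (huO : ∀ᵐ ω ∂μ, u ω ∈ Oset (x ω) (y ω) (z ω))
    (q : Ω → H) (hq : ∀ ω, IsProjPt (Oset (x ω) (y ω) (z ω)) (x ω) (q ω)) :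
    AEMeasurable q μ ∧ MemLp q 2 μ := by
  have hmeas : AEMeasurable q μ := by
    have hform : q = fun ω => haugazeau (x ω) (y ω) (z ω) := funext fun ω => (hq ω).eq_haugazeau
    have hxyz : AEMeasurable (fun ω => (x ω, y ω, z ω)) μ :=
      hx.aestronglyMeasurable.aemeasurable.prodMk
        (hy.aestronglyMeasurable.aemeasurable.prodMk hz.aestronglyMeasurable.aemeasurable)
    have hcomp := measurable_haugazeau.comp_aemeasurable hxyz
    rwa [Function.comp_def, ← hform] at hcomp
  refine ⟨hmeas, ((hx.sub hu).norm.add hx.norm).mono hmeas.aestronglyMeasurable ?_⟩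
  filter_upwards [huO] with ω hω
  calc ‖q ω‖ = ‖x ω - (x ω - q ω)‖ := by rw [sub_sub_cancel]
    _ ≤ ‖x ω‖ + ‖x ω - q ω‖ := norm_sub_le _ _
    _ ≤ ‖x ω - u ω‖ + ‖x ω‖ := by linarith [(hq ω).2 (u ω) hω]
    _ ≤ ‖‖x ω - u ω‖ + ‖x ω‖‖ := le_abs_self _
end

section
/- Let (x_n) be generated by Algorithm 1.1 for a nonempty closed convex set Z ⊆ H and x₀ ∈ L²(Ω,ℱ,P;H), with each x_n square-integrable. Then there exists a square-integrable real random variable ℓ such that, P-almost surely, the sequence (‖x_n − x₀‖)_{n∈ℕ} is nondecreasing and converges to ℓ, and ℓ ≤ ‖proj_Z x₀ − x₀‖ P-almost surely, where proj_Z denotes the metric projection onto Z. -/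
open MeasureTheory Filter RealInnerProductSpace Topology

/-- A point of `H(x,y)` is at least as far from `x` as `y` is. -/
theorem norm_sub_le_of_mem_halfSpace {H : Type*} [NormedAddCommGroup H] [InnerProductSpace ℝ H]
    {x y z : H} (h : z ∈ halfSpace x y) : ‖y - x‖ ≤ ‖z - x‖ := by
  have h1 : ⟪z - y, x - y⟫ ≤ 0 := h
  have h2 : ‖z - x‖ ^ 2 = ‖z - y‖ ^ 2 - 2 * ⟪z - y, x - y⟫ + ‖x - y‖ ^ 2 := by
    rw [← norm_sub_sq_real, sub_sub_sub_cancel_right]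
  rw [norm_sub_rev y x]
  exact le_of_sq_le_sq (by nlinarith [sq_nonneg ‖z - y‖]) (norm_nonneg _)

/-- Relaxation enlarges the half-space. -/
theorem halfSpace_subset_halfSpace_relaxed {H : Type*} [NormedAddCommGroup H]
    [InnerProductSpace ℝ H] (x a : H) {t : ℝ} (ht : t ∈ Set.Icc (0 : ℝ) 1) :
    halfSpace x a ⊆ halfSpace x (x + t • (a - x)) := by
  intro z hz
  have h1 : ⟪z - a, x - a⟫ ≤ 0 := hz
  change ⟪z - (x + t • (a - x)), x - (x + t • (a - x))⟫ ≤ 0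
  have e1 : z - (x + t • (a - x)) = (z - a) - (1 - t) • (x - a) := by module
  have e2 : x - (x + t • (a - x)) = t • (x - a) := by module
  rw [e1, e2, inner_smul_right, inner_sub_left, real_inner_smul_left, real_inner_self_eq_norm_sq]
  have h2 : 0 ≤ (1 - t) * ‖x - a‖ ^ 2 := mul_nonneg (by linarith [ht.2]) (sq_nonneg _)
  exact mul_nonpos_of_nonneg_of_nonpos ht.1 (by linarith)

theorem convex_halfSpace {H : Type*} [NormedAddCommGroup H] [InnerProductSpace ℝ H] (x y : H) :
    Convex ℝ (halfSpace x y) := by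
  intro u hu v hv s t hs ht hst
  have hu' : ⟪u - y, x - y⟫ ≤ 0 := hu
  have hv' : ⟪v - y, x - y⟫ ≤ 0 := hv
  change ⟪s • u + t • v - y, x - y⟫ ≤ 0
  have e : s • u + t • v - y = s • (u - y) + t • (v - y) := by
    obtain rfl : s = 1 - t := by linarith
    module
  rw [e, inner_add_left, real_inner_smul_left, real_inner_smul_left]
  exact add_nonpos (mul_nonpos_of_nonneg_of_nonpos hs hu') (mul_nonpos_of_nonneg_of_nonpos ht hv')

/-- A convex set lies in the half-space determined by a point and its projection. -/
theorem IsProjPt.subset_halfSpace {H : Type*} [NormedAddCommGroup H] [InnerProductSpace ℝ H]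
    {C : Set H} {x q : H} (h : IsProjPt C x q) (hC : Convex ℝ C) : C ⊆ halfSpace x q := by
  intro z hz
  have hinf : ‖x - q‖ = ⨅ w : C, ‖x - w‖ := by
    have : Nonempty C := ⟨⟨q, h.1⟩⟩
    refine le_antisymm (le_ciInf fun w => h.2 w w.2) ?_
    exact ciInf_le (f := fun w : C => ‖x - w‖)
      ⟨0, by rintro _ ⟨w, rfl⟩; exact norm_nonneg _⟩ ⟨q, h.1⟩
  change ⟪z - q, x - q⟫ ≤ 0
  rw [real_inner_comm]
  exact (norm_eq_iInf_iff_real_inner_le_zero hC h.1).1 hinf z hz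

/-- One step of the algorithm: if `Z` lies in both half-spaces, then the new iterate lies in the
first one, and `Z` lies in the half-space determined by the new iterate. -/
theorem IsProjPt.haugazeau_step {H : Type*} [NormedAddCommGroup H] [InnerProductSpace ℝ H]
    {Z : Set H} (hZ : Z.Nonempty) {x y z q : H} (h : IsProjPt (Oset x y z) x q)
    (h₁ : Z ⊆ halfSpace x y) (h₂ : Z ⊆ halfSpace y z) :
    q ∈ halfSpace x y ∧ Z ⊆ halfSpace x q := by
  rw [Oset, if_pos (hZ.mono (Set.subset_inter h₁ h₂))] at h
  exact ⟨h.1.1, (Set.subset_inter h₁ h₂).trans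
    (h.subset_halfSpace ((convex_halfSpace x y).inter (convex_halfSpace y z)))⟩

/-- Theorem 3.1(iii): a.s. the sequence `(‖xₙ - x₀‖)` increases to a square-integrable limit
`ℓ ≤ ‖proj_Z x₀ - x₀‖`. -/
theorem haugazeau_monotone_limit
    {Ω : Type*} [MeasurableSpace Ω] (μ : Measure Ω)
    [IsProbabilityMeasure μ] [μ.IsComplete]
    {H : Type*} [NormedAddCommGroup H] [InnerProductSpace ℝ H] [CompleteSpace H]
    [SecondCountableTopology H] [MeasurableSpace H] [BorelSpace H]
    (Z : Set H) (hZne : Z.Nonempty) (hZcl : IsClosed Z) (hZconv : Convex ℝ Z)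
    (x a r : ℕ → Ω → H) (lam : ℕ → Ω → ℝ)
    (hx0 : MemLp (x 0) 2 μ)
    (hxL2 : ∀ n, MemLp (x n) 2 μ)
    (ha : ∀ n, MemLp (a n) 2 μ)
    (haZ : ∀ n, ∀ᵐ ω ∂μ, Z ⊆ halfSpace (x n ω) (a n ω))
    (hlam_meas : ∀ n, Measurable (lam n))
    (hlam : ∀ n ω, lam n ω ∈ Set.Ioc (0 : ℝ) 1)
    (hr : ∀ n ω, r n ω = x n ω + lam n ω • (a n ω - x n ω))
    (hxsucc : ∀ n ω, IsProjPt (Oset (x 0 ω) (x n ω) (r n ω)) (x 0 ω) (x (n + 1) ω))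
    (pZ : H → H) (hpZ : ∀ v : H, IsProjPt Z v (pZ v)) :
    ∃ ℓ : Ω → ℝ, MemLp ℓ 2 μ ∧
      ∀ᵐ ω ∂μ, Monotone (fun n => ‖x n ω - x 0 ω‖) ∧
        Tendsto (fun n => ‖x n ω - x 0 ω‖) atTop (𝓝 (ℓ ω)) ∧
        ℓ ω ≤ ‖pZ (x 0 ω) - x 0 ω‖ := by
  have key : ∀ᵐ ω ∂μ, Monotone (fun n => ‖x n ω - x 0 ω‖) ∧
      ∀ n, ∀ z ∈ Z, ‖x n ω - x 0 ω‖ ≤ ‖z - x 0 ω‖ := by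
    filter_upwards [ae_all_iff.2 haZ] with ω hω
    have hrelax : ∀ n, Z ⊆ halfSpace (x n ω) (r n ω) := fun n => by
      rw [hr]
      exact (hω n).trans
        (halfSpace_subset_halfSpace_relaxed _ _ (Set.Ioc_subset_Icc_self (hlam n ω)))
    have hsub : ∀ n, Z ⊆ halfSpace (x 0 ω) (x n ω) := by
      intro n
      induction n with
      | zero => intro z _; simp [halfSpace]
      | succ n ih => exact ((hxsucc n ω).haugazeau_step hZne ih (hrelax n)).2
    exact ⟨monotone_nat_of_le_succ fun n => norm_sub_le_of_mem_halfSpace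
      ((hxsucc n ω).haugazeau_step hZne (hsub n) (hrelax n)).1,
      fun n z hz => norm_sub_le_of_mem_halfSpace (hsub n hz)⟩
  obtain ⟨z, hz⟩ := hZne
  have hlim : ∀ᵐ ω ∂μ,
      Tendsto (fun n => ‖x n ω - x 0 ω‖) atTop (𝓝 (⨆ n, ‖x n ω - x 0 ω‖)) := by
    filter_upwards [key] with ω hω
    exact tendsto_atTop_ciSup hω.1 ⟨‖z - x 0 ω‖, by rintro _ ⟨n, rfl⟩; exact hω.2 n z hz⟩
  refine ⟨fun ω => ⨆ n, ‖x n ω - x 0 ω‖, ?_, ?_⟩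
  · refine ((memLp_const z).sub hx0).of_le (aestronglyMeasurable_of_tendsto_ae atTop
      (fun n => ((hxL2 n).sub hx0).aestronglyMeasurable.norm) hlim) ?_
    filter_upwards [key] with ω hω
    rw [Real.norm_of_nonneg (Real.iSup_nonneg fun n => norm_nonneg _)]
    exact ciSup_le fun n => hω.2 n z hz
  · filter_upwards [key, hlim] with ω hω hωlim
    exact ⟨hω.1, hωlim, ciSup_le fun n => hω.2 n _ (hpZ (x 0 ω)).1⟩
end
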